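/- arXiv:2605.06275 — 2 statements merged into one kernel-verified Lean document; each statement's English description precedes it below -/
import Mathlib

section
/- Let λ_1,…,λ_M be positive reals and γ̄ > 0. For each nonempty subset s of {1,…,M} set Ξ_s = ∑_{j∈s} λ_j^{−1}. Then the function F(x) = ∏_{n=1}^{M} (1 − exp(−x/(γ̄λ_n))) is differentiable at every x ∈ ℝ with derivative F′(x) = ∑_{k=1}^{M} (−1)^{k+1} ∑_{s: |s|=k} (Ξ_s/γ̄) exp(−(Ξ_s/γ̄) x). -/
open Finset Real

/-- Inclusion–exclusion expansion of a product of complementary exponentials. -/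
theorem prod_one_sub_exp_neg_mul {ι : Type*} (t : Finset ι) (a : ι → ℝ) (y : ℝ) :
    ∏ n ∈ t, (1 - Real.exp (-(a n) * y)) =
      ∑ s ∈ t.powerset, (-1 : ℝ) ^ #s * Real.exp (-(∑ j ∈ s, a j) * y) := by
  simp only [sub_eq_add_neg, Finset.prod_one_add, Finset.prod_neg, ← Real.exp_sum,
    ← Finset.sum_mul, Finset.sum_neg_distrib]

/-- The derivative of a product of complementary exponentials, by inclusion–exclusion. -/
theorem hasDerivAt_prod_one_sub_exp_neg_mul {ι : Type*} (t : Finset ι) (a : ι → ℝ) (x : ℝ) :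
    HasDerivAt (fun y : ℝ => ∏ n ∈ t, (1 - Real.exp (-(a n) * y)))
      (∑ k ∈ Finset.Icc 1 #t, (-1 : ℝ) ^ (k + 1) *
        ∑ s ∈ Finset.powersetCard k t,
          (∑ j ∈ s, a j) * Real.exp (-(∑ j ∈ s, a j) * x)) x := by
  simp only [prod_one_sub_exp_neg_mul]
  refine (HasDerivAt.fun_sum fun s _ =>
    ((hasDerivAt_id x).const_mul (-(∑ j ∈ s, a j))).exp.const_mul ((-1 : ℝ) ^ #s)).congr_deriv ?_
  rw [Finset.sum_powerset, Finset.range_eq_Ico, Finset.sum_eq_sum_Ico_succ_bot (by simp)]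
  simp only [Finset.powersetCard_zero, Finset.sum_singleton, Finset.sum_empty, neg_zero,
    zero_mul, mul_zero, zero_add]
  refine Finset.sum_congr (by ext; simp) fun k _ => ?_
  rw [Finset.mul_sum]
  refine Finset.sum_congr rfl fun s hs => ?_
  rw [(Finset.mem_powersetCard.mp hs).2, id, pow_succ]
  ring

/-- **Exact PDF of the post-selection SNR (Proposition 1).**
Let `lam 1, …, lam M` be positive reals and `gbar > 0` (the transmit SNR `γ̄`).  For each
nonempty subset `s` of `{1, …, M}` set `Ξ s = ∑_{j∈s} (lam j)⁻¹`.  Then the CDF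
`F x = ∏ n, (1 - exp (-x / (gbar * lam n)))` is differentiable at every `x : ℝ` with
derivative `F' x = ∑_{k=1}^{M} (-1)^{k+1} ∑_{s : |s|=k} (Ξ s / gbar) * exp (-(Ξ s / gbar) * x)`. -/
theorem hasDerivAt_prod_cdf_inclusion_exclusion
    (M : ℕ) (lam : Fin M → ℝ) (hlam : ∀ n, 0 < lam n)
    (gbar : ℝ) (hg : 0 < gbar) (x : ℝ) :
    HasDerivAt (fun y : ℝ => ∏ n, (1 - Real.exp (-y / (gbar * lam n))))
      (∑ k ∈ Finset.Icc 1 M, (-1 : ℝ) ^ (k + 1) *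
        ∑ s ∈ Finset.powersetCard k (Finset.univ : Finset (Fin M)),
          ((∑ j ∈ s, (lam j)⁻¹) / gbar) *
            Real.exp (-((∑ j ∈ s, (lam j)⁻¹) / gbar) * x)) x := by
  convert hasDerivAt_prod_one_sub_exp_neg_mul Finset.univ (fun n => (lam n)⁻¹ / gbar) x using 1
  · funext y
    refine Finset.prod_congr rfl fun n _ => ?_
    congr 2
    rw [div_eq_mul_inv, mul_inv]
    ring
  · simp only [Finset.card_univ, Fintype.card_fin, Finset.sum_div]
end

section
/- Let L > 0, χ > 0, ΔS ≥ 0 be reals, let N ≥ 1 be a natural number, and let τ ≥ 0 satisfy L − Nτ > 0. Then ΔS − χ·(1/√(L − Nτ) − 1/√L) ≥ 0 if and only if τ ≤ (L/N) · [1 − (1 + ΔS·√L/χ)^{−2}]. -/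
open Real

/-- **Proposition 3: rate-based operational region of FAS vs. FPA.**
Let `L > 0`, `χ > 0`, `ΔS ≥ 0` be reals, let `N ≥ 1` be a natural number, and let
`τ ≥ 0` satisfy `L - N τ > 0`.  Then
`ΔS - χ * (1/√(L - N τ) - 1/√L) ≥ 0` if and only if
`τ ≤ (L/N) * (1 - (1 + ΔS * √L / χ)^{-2})`. -/
theorem fas_fpa_rate_threshold
    (L χ ΔS : ℝ) (hL : 0 < L) (hχ : 0 < χ) (hΔS : 0 ≤ ΔS)
    (N : ℕ) (hN : 1 ≤ N)
    (τ : ℝ) (hτ : 0 ≤ τ) (hLN : 0 < L - N * τ) :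
    0 ≤ ΔS - χ * (1 / Real.sqrt (L - N * τ) - 1 / Real.sqrt L) ↔
      τ ≤ (L / N) * (1 - (1 + ΔS * Real.sqrt L / χ) ^ (-2 : ℤ)) := by
  have hN' : (0 : ℝ) < N := by exact_mod_cast hN
  have ha : 0 < √(L - N * τ) := Real.sqrt_pos.mpr hLN
  have hb : 0 < √L := Real.sqrt_pos.mpr hL
  have ha2 : √(L - N * τ) ^ 2 = L - N * τ := Real.sq_sqrt hLN.le
  have hb2 : √L ^ 2 = L := Real.sq_sqrt hL.le
  have hu : 0 < 1 + ΔS * √L / χ := by positivity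
  have hleft : ΔS - χ * (1 / √(L - N * τ) - 1 / √L) =
      ((1 + ΔS * √L / χ) * √(L - N * τ) - √L) * (χ / (√(L - N * τ) * √L)) := by
    field_simp
    ring
  have hright : (L / N) * (1 - (1 + ΔS * √L / χ) ^ (-2 : ℤ)) - τ =
      (((1 + ΔS * √L / χ) * √(L - N * τ)) ^ 2 - √L ^ 2) / (N * (1 + ΔS * √L / χ) ^ 2) := by
    rw [mul_pow, ha2, hb2, zpow_neg, zpow_ofNat]
    generalize 1 + ΔS * √L / χ = u at hu ⊢
    field_simp
    ring
  rw [← sub_nonneg (b := τ), hleft, hright, mul_nonneg_iff_of_pos_right (by positivity),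
    le_div_iff₀ (by positivity), zero_mul, sub_nonneg, sub_nonneg,
    sq_le_sq₀ hb.le (by positivity)]
end
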